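/- arXiv:1709.05299 — 10 statements merged into one kernel-verified Lean document; each statement's English description precedes it below -/
import Mathlib

section
/- (Lemma 1) Let $a \ge b > 0$ and let $t \in [0,1]$ with $s = 1 - t$. Then $(a - b)\Big( 1 + t b - \big(1 + s a + t b\big)^{\frac{t b}{s a + t b}} \Big) \ge 0$, where for $t = 1$ and $a = b$ the exponent is $1$ (the expression $(1+sa+tb)^{tb/(sa+tb)}$ is well defined since $sa + tb > 0$ for $t \in [0,1]$, $a \ge b > 0$). -/
open Real

/-- Lemma 1 of the paper: for `a ≥ b > 0`, `t ∈ [0,1]`, `s = 1 - t`,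
`(a - b) * (1 + t*b - (1 + s*a + t*b)^(t*b/(s*a + t*b))) ≥ 0`. -/
theorem lemma1_feasibility (a b t s : ℝ) (hb : 0 < b) (hab : b ≤ a)
    (ht0 : 0 ≤ t) (ht1 : t ≤ 1) (hs : s = 1 - t) :
    0 ≤ (a - b) * (1 + t * b - (1 + s * a + t * b) ^ (t * b / (s * a + t * b))) := by
  have hs0 : 0 ≤ s := by linarith
  have hsa : 0 ≤ s * a := mul_nonneg hs0 (hb.le.trans hab)
  have htb : 0 ≤ t * b := mul_nonneg ht0 hb.le
  have hpos : 0 < s * a + t * b := by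
    subst hs
    nlinarith [mul_le_mul_of_nonneg_left hab hs0]
  have bernoulli := rpow_one_add_le_one_add_mul_self
    (by linarith : -1 ≤ s * a + t * b) (div_nonneg htb hpos.le)
    ((div_le_one hpos).2 (by linarith))
  rw [div_mul_cancel₀ _ hpos.ne', ← add_assoc] at bernoulli
  exact mul_nonneg (sub_nonneg.2 hab) (sub_nonneg.2 bernoulli)
end

section
/- Let $a \ge b > 0$. The function $f : [0,1] \to \mathbb{R}$ defined by $f(t) = \big(1 + (1-t)a + t b\big)^{\frac{t b}{(1-t) a + t b}}$ is convex on $[0,1]$. Moreover $f(0) = 1$ and $f(1) = 1 + b$, so $f$ agrees with the linear function $t \mapsto 1 + t b$ at the endpoints $t = 0$ and $t = 1$. -/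
open Real

lemma log_one_add_div_eq_integral {s : ℝ} (hs : 0 < s) :
    log (1 + s) / s = ∫ u in (0 : ℝ)..1, (1 + s * u)⁻¹ := by
  have h := intervalIntegral.mul_integral_comp_add_mul (f := fun x : ℝ => x⁻¹) (a := 0) (b := 1) s 1
  rw [mul_zero, add_zero, mul_one, integral_inv_of_pos one_pos (by positivity), div_one] at h
  rw [← h, mul_div_cancel_left₀ _ hs.ne']

lemma intervalIntegrable_inv_one_add_mul {s : ℝ} (hs : 0 < s) :
    IntervalIntegrable (fun u : ℝ => (1 + s * u)⁻¹) MeasureTheory.volume 0 1 := by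
  refine ContinuousOn.intervalIntegrable_of_Icc zero_le_one ?_
  refine ContinuousOn.inv₀ (by fun_prop) fun u hu => ?_
  have := mul_nonneg hs.le hu.1
  positivity

lemma antitoneOn_log_one_add_div :
    AntitoneOn (fun s : ℝ => log (1 + s) / s) (Set.Ioi 0) := by
  intro x hx y hy hxy
  rw [Set.mem_Ioi] at hx hy
  simp only [log_one_add_div_eq_integral hx, log_one_add_div_eq_integral hy]
  refine intervalIntegral.integral_mono_on zero_le_one (intervalIntegrable_inv_one_add_mul hy)
    (intervalIntegrable_inv_one_add_mul hx) fun u hu => ?_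
  have hu0 := hu.1
  gcongr

lemma convexOn_log_one_add_div :
    ConvexOn ℝ (Set.Ioi 0) (fun s : ℝ => log (1 + s) / s) := by
  refine ⟨convex_Ioi 0, fun x hx y hy p q hp hq hpq => ?_⟩
  have hz : 0 < p • x + q • y := convex_Ioi 0 hx hy hp hq hpq
  rw [Set.mem_Ioi] at hx hy
  simp only [log_one_add_div_eq_integral hx, log_one_add_div_eq_integral hy,
    log_one_add_div_eq_integral hz]
  have hix := (intervalIntegrable_inv_one_add_mul hx).const_mul p
  have hiy := (intervalIntegrable_inv_one_add_mul hy).const_mul q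
  simp only [smul_eq_mul] at hz ⊢
  rw [← intervalIntegral.integral_const_mul,
    ← intervalIntegral.integral_const_mul, ← intervalIntegral.integral_add hix hiy]
  refine intervalIntegral.integral_mono_on zero_le_one (intervalIntegrable_inv_one_add_mul hz)
    (hix.add hiy) fun u hu => ?_
  have hu0 := hu.1
  have h := (convexOn_zpow (𝕜 := ℝ) (-1)).2 (x := 1 + x * u) (Set.mem_Ioi.2 (by positivity))
    (y := 1 + y * u) (Set.mem_Ioi.2 (by positivity)) hp hq hpq
  simp only [zpow_neg_one, smul_eq_mul] at h ⊢
  have e : p * (1 + x * u) + q * (1 + y * u) = 1 + (p * x + q * y) * u := by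
    linear_combination hpq
  rwa [e] at h

/-- Key step in the proof of Lemma 1: for `a ≥ b > 0`, the function
`f t = (1 + (1-t)*a + t*b)^(t*b/((1-t)*a + t*b))` is convex on `[0,1]`,
and it agrees with the linear function `t ↦ 1 + t*b` at the endpoints:
`f 0 = 1` and `f 1 = 1 + b`. -/
theorem convexity_key_step (a b : ℝ) (hb : 0 < b) (hab : b ≤ a) :
    ConvexOn ℝ (Set.Icc (0 : ℝ) 1)
      (fun t : ℝ => (1 + (1 - t) * a + t * b) ^ (t * b / ((1 - t) * a + t * b))) ∧
    (fun t : ℝ => (1 + (1 - t) * a + t * b) ^ (t * b / ((1 - t) * a + t * b))) 0 = 1 ∧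
    (fun t : ℝ => (1 + (1 - t) * a + t * b) ^ (t * b / ((1 - t) * a + t * b))) 1 = 1 + b := by
  refine ⟨?_, by simp, by simp [hb.ne']⟩
  have hpos : ∀ t ∈ Set.Icc (0 : ℝ) 1, 0 < (1 - t) * a + t * b := fun t ht => by
    nlinarith [mul_nonneg (sub_nonneg.2 ht.2) (sub_nonneg.2 hab)]
  have hlin : ConvexOn ℝ (Set.Icc (0 : ℝ) 1) (fun t : ℝ => t * b) :=
    ⟨convex_Icc 0 1, fun x _ y _ p q _ _ _ => by simp only [smul_eq_mul]; apply le_of_eq; ring⟩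
  have hL : ConvexOn ℝ (Set.Icc (0 : ℝ) 1)
      (fun t : ℝ => log (1 + ((1 - t) * a + t * b)) / ((1 - t) * a + t * b)) := by
    refine ⟨convex_Icc 0 1, fun x hx y hy p q hp hq hpq => ?_⟩
    have h := convexOn_log_one_add_div.2 (hpos x hx) (hpos y hy) hp hq hpq
    have e : (1 - (p • x + q • y)) * a + (p • x + q • y) * b =
        p • ((1 - x) * a + x * b) + q • ((1 - y) * a + y * b) := by
      simp only [smul_eq_mul]
      linear_combination -a * hpq
    simpa only [e] using h
  have hmono : MonovaryOn (fun t : ℝ => t * b)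
      (fun t : ℝ => log (1 + ((1 - t) * a + t * b)) / ((1 - t) * a + t * b))
      (Set.Icc (0 : ℝ) 1) := by
    refine MonotoneOn.monovaryOn (fun x _ y _ hxy => by gcongr) fun x hx y hy hxy => ?_
    refine antitoneOn_log_one_add_div (hpos y hy) (hpos x hx) ?_
    nlinarith [mul_nonneg (sub_nonneg.2 hxy) (sub_nonneg.2 hab)]
  have hg := hlin.mul hL (fun t ht => mul_nonneg ht.1 hb.le)
    (fun t ht => div_nonneg (log_nonneg (by linarith [hpos t ht])) (hpos t ht).le) hmono
  have hexp : ConvexOn ℝ (Set.Icc (0 : ℝ) 1) (exp ∘ _) :=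
    ⟨hg.1, fun x hx y hy p q hp hq hpq => (exp_le_exp.2 (hg.2 hx hy hp hq hpq)).trans
      (convexOn_exp.2 (Set.mem_univ _) (Set.mem_univ _) hp hq hpq)⟩
  refine hexp.congr fun t ht => ?_
  have := hpos t ht
  simp only [Function.comp_apply, Pi.mul_apply]
  rw [rpow_def_of_pos (by linarith), ← add_assoc]
  congr 1
  ring
end

section
/- Let $a \ge b > 0$, let $t \in (0,1)$, $s = 1-t$, and set $\lambda_1 = \frac{s a}{s a + t b}$, $\lambda_2 = \frac{t b}{s a + t b}$ (the optimal OMA degrees-of-freedom split). Then $\frac{(1 + s a/\lambda_1)^{\lambda_1} - 1}{a} \;\le\; \frac{1 + b - (1 + t b/\lambda_2)^{\lambda_2}}{b\,(1 + t b/\lambda_2)^{\lambda_2}}$; i.e., the NOMA power-allocation interval defined by constraints (12a) and (12b) of the paper is nonempty. -/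
open Real

/-- The NOMA power-allocation interval defined by constraints (12a)–(12b) is nonempty:
for `a ≥ b > 0`, `t ∈ (0,1)`, `s = 1 - t`, and the optimal DoF split
`λ₁ = s*a/(s*a + t*b)`, `λ₂ = t*b/(s*a + t*b)`, the lower bound does not
exceed the upper bound. -/
theorem noma_interval_nonempty (a b t s lam1 lam2 : ℝ) (hb : 0 < b) (hab : b ≤ a)
    (ht0 : 0 < t) (ht1 : t < 1) (hs : s = 1 - t)
    (hl1 : lam1 = s * a / (s * a + t * b)) (hl2 : lam2 = t * b / (s * a + t * b)) :
    ((1 + s * a / lam1) ^ lam1 - 1) / a ≤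
      (1 + b - (1 + t * b / lam2) ^ lam2) / (b * (1 + t * b / lam2) ^ lam2) := by
  have ha : 0 < a := hb.trans_le hab
  have hs0 : 0 < s := by linarith
  have hsa : 0 < s * a := mul_pos hs0 ha
  have htb : 0 < t * b := mul_pos ht0 hb
  have hS : 0 < s * a + t * b := add_pos hsa htb
  have h1 : s * a / lam1 = s * a + t * b := by rw [hl1]; field_simp
  have h2 : t * b / lam2 = s * a + t * b := by rw [hl2]; field_simp
  have hlam2 : 0 ≤ lam2 := by rw [hl2]; positivity
  have hlam2' : lam2 ≤ 1 := by rw [hl2, div_le_one hS]; linarith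
  have hsum : lam1 + lam2 = 1 := by rw [hl1, hl2]; field_simp
  have hmul : lam2 * (s * a + t * b) = t * b := by rw [hl2]; field_simp
  rw [h1, h2]
  have hY := rpow_one_add_le_one_add_mul_self (s := s * a + t * b) (by linarith) hlam2 hlam2'
  have hXY : (1 + (s * a + t * b)) ^ lam1 * (1 + (s * a + t * b)) ^ lam2
      = 1 + (s * a + t * b) := by
    rw [← rpow_add (by linarith), hsum, rpow_one]
  have hY0 : 0 < (1 + (s * a + t * b)) ^ lam2 := rpow_pos_of_pos (by linarith) _
  rw [hmul] at hY
  generalize (1 + (s * a + t * b)) ^ lam1 = X at *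
  generalize (1 + (s * a + t * b)) ^ lam2 = Y at *
  rw [div_le_div_iff₀ ha (mul_pos hb hY0)]
  subst hs
  linear_combination b * hXY + mul_le_mul_of_nonneg_left hY (sub_nonneg.2 hab)
end

section
/- (Main result, arbitrary OMA power and optimal DoF) Let $a \ge b > 0$, let $t \in (0,1)$, $s = 1 - t$, and set $\lambda_1 = \frac{s a}{s a + t b}$, $\lambda_2 = \frac{t b}{s a + t b}$. Then there exists $c \in [0,1]$ such that simultaneously $\log_2(1 + c\, a) \ge \lambda_1 \log_2(1 + s a + t b)$ and $\log_2\Big(1 + \frac{(1-c)\, b}{1 + c\, b}\Big) \ge \lambda_2 \log_2(1 + s a + t b)$; i.e., MIMO-NOMA with power split $(\alpha_1^2, \alpha_2^2) = (c, 1-c)$ achieves an individual rate for each user at least as large as that of MIMO-OMA with arbitrary power coefficients $(s,t)$ and the sum-rate-optimal DoF split. -/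
open Real

/-- Main result (arbitrary OMA power, optimal DoF): there exists a NOMA power split
`(c, 1-c)` whose individual rate for each user is at least the corresponding OMA
individual rate with power coefficients `(s,t)` and sum-rate-optimal DoF split. -/
theorem noma_dominates_oma_optimal_dof (a b t s lam1 lam2 : ℝ) (hb : 0 < b) (hab : b ≤ a)
    (ht0 : 0 < t) (ht1 : t < 1) (hs : s = 1 - t)
    (hl1 : lam1 = s * a / (s * a + t * b)) (hl2 : lam2 = t * b / (s * a + t * b)) :
    ∃ c : ℝ, c ∈ Set.Icc (0 : ℝ) 1 ∧
      lam1 * logb 2 (1 + s * a + t * b) ≤ logb 2 (1 + c * a) ∧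
      lam2 * logb 2 (1 + s * a + t * b) ≤ logb 2 (1 + (1 - c) * b / (1 + c * b)) := by
  have ha : 0 < a := hb.trans_le hab
  have hs0 : 0 < s := by linarith
  have hx : 0 < s * a := mul_pos hs0 ha
  have hy : 0 < t * b := mul_pos ht0 hb
  have hxy : 0 < s * a + t * b := add_pos hx hy
  have hsum : lam1 + lam2 = 1 := by rw [hl1, hl2, ← add_div, div_self hxy.ne']
  have h1 : 0 ≤ lam1 := hl1 ▸ (div_pos hx hxy).le
  have h2 : 0 ≤ lam2 := hl2 ▸ (div_pos hy hxy).le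
  have hm1 : lam1 * (s * a + t * b) = s * a := by rw [hl1, div_mul_cancel₀ _ hxy.ne']
  have hm2 : lam2 * (s * a + t * b) = t * b := by rw [hl2, div_mul_cancel₀ _ hxy.ne']
  rw [add_assoc]
  have hS : 0 < 1 + (s * a + t * b) := by linarith
  rw [← logb_rpow_eq_mul_logb_of_pos hS, ← logb_rpow_eq_mul_logb_of_pos hS]
  have hA : (1 + (s * a + t * b)) ^ lam1 ≤ 1 + s * a :=
    (rpow_one_add_le_one_add_mul_self (by linarith) h1 (by linarith)).trans_eq (by rw [hm1])
  have hB : (1 + (s * a + t * b)) ^ lam2 ≤ 1 + t * b :=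
    (rpow_one_add_le_one_add_mul_self (by linarith) h2 (by linarith)).trans_eq (by rw [hm2])
  have hA1 : 1 ≤ (1 + (s * a + t * b)) ^ lam1 := one_le_rpow (by linarith) h1
  have hB0 : 0 < (1 + (s * a + t * b)) ^ lam2 := rpow_pos_of_pos hS _
  have hAB : (1 + (s * a + t * b)) ^ lam1 * (1 + (s * a + t * b)) ^ lam2
      = 1 + (s * a + t * b) := by rw [← rpow_add hS, hsum, rpow_one]
  generalize (1 + (s * a + t * b)) ^ lam1 = A at *
  generalize (1 + (s * a + t * b)) ^ lam2 = B at *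
  obtain ⟨c, hc⟩ : ∃ c, c * a = A - 1 := ⟨(A - 1) / a, div_mul_cancel₀ _ ha.ne'⟩
  have hc0 : 0 ≤ c := nonneg_of_mul_nonneg_left (by linarith) ha
  have hc1 : c ≤ 1 := by
    refine le_of_mul_le_mul_right ?_ ha
    nlinarith
  have hcb : 0 < 1 + c * b := by positivity
  refine ⟨c, ⟨hc0, hc1⟩, by rw [hc, add_sub_cancel], logb_le_logb_of_le one_lt_two hB0 ?_⟩
  have hweak : 1 + (1 - c) * b / (1 + c * b) = (1 + b) / (1 + c * b) := by
    field_simp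
    ring
  rw [hweak, le_div_iff₀ hcb]
  refine le_of_mul_le_mul_left ?_ ha
  calc a * (B * (1 + c * b)) = (a - b) * B + b * (A * B) := by linear_combination b * B * hc
    _ ≤ (a - b) * (1 + t * b) + b * (1 + (s * a + t * b)) := by
      rw [hAB]
      gcongr
    _ = a * (1 + b) := by rw [hs]; ring
end

section
/- Let $a \ge b > 0$, let $t \in (0,1)$, $s = 1 - t$, and set $\lambda_1 = \frac{s a}{s a + t b}$, $\lambda_2 = \frac{t b}{s a + t b}$. If $c \in [0,1]$ satisfies $\frac{(1 + sa + tb)^{\lambda_1} - 1}{a} \le c \le \frac{1 + b - (1 + sa + tb)^{\lambda_2}}{b\,(1 + sa + tb)^{\lambda_2}}$, then the NOMA sum rate dominates the maximum OMA sum rate: $\log_2(1 + c\, a) + \log_2\Big(1 + \frac{(1-c)\, b}{1 + c\, b}\Big) \ge \log_2(1 + s a + t b)$. -/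
open Real

/-- For any NOMA power coefficient `c` in the feasible interval (12), the NOMA sum
rate dominates the maximum OMA sum rate `log₂(1 + s*a + t*b)`. -/
theorem noma_sum_rate_dominates (a b t s lam1 lam2 c : ℝ) (hb : 0 < b) (hab : b ≤ a)
    (ht0 : 0 < t) (ht1 : t < 1) (hs : s = 1 - t)
    (hl1 : lam1 = s * a / (s * a + t * b)) (hl2 : lam2 = t * b / (s * a + t * b))
    (hc0 : 0 ≤ c) (hc1 : c ≤ 1)
    (hlow : ((1 + s * a + t * b) ^ lam1 - 1) / a ≤ c)
    (hhigh : c ≤ (1 + b - (1 + s * a + t * b) ^ lam2) /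
      (b * (1 + s * a + t * b) ^ lam2)) :
    logb 2 (1 + s * a + t * b) ≤
      logb 2 (1 + c * a) + logb 2 (1 + (1 - c) * b / (1 + c * b)) := by
  have ha : 0 < a := hb.trans_le hab
  have hs0 : 0 < s := by linarith
  have hsum : 0 < s * a + t * b := by positivity
  have hW : 0 < 1 + s * a + t * b := by linarith
  have hlam : lam1 + lam2 = 1 := by
    rw [hl1, hl2, ← add_div, div_self hsum.ne']
  have hprod : (1 + s * a + t * b) ^ lam1 * (1 + s * a + t * b) ^ lam2 =
      1 + s * a + t * b := by
    rw [← rpow_add hW, hlam, rpow_one]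
  have hp1 := rpow_pos_of_pos hW lam1
  have hp2 := rpow_pos_of_pos hW lam2
  have hcb : 0 < 1 + c * b := by positivity
  have hstrong : (1 + s * a + t * b) ^ lam1 ≤ 1 + c * a := by
    rw [div_le_iff₀ ha] at hlow
    linarith
  have hweak : (1 + s * a + t * b) ^ lam2 ≤ 1 + (1 - c) * b / (1 + c * b) := by
    have hrate : 1 + (1 - c) * b / (1 + c * b) = (1 + b) / (1 + c * b) := by
      field_simp
      ring
    rw [le_div_iff₀ (mul_pos hb hp2)] at hhigh
    rw [hrate, le_div_iff₀ hcb]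
    linarith
  rw [← logb_mul (hp1.trans_le hstrong).ne' (hp2.trans_le hweak).ne']
  refine logb_le_logb_of_le one_lt_two hW ?_
  calc 1 + s * a + t * b
      = (1 + s * a + t * b) ^ lam1 * (1 + s * a + t * b) ^ lam2 := hprod.symm
    _ ≤ _ := mul_le_mul hstrong hweak hp2.le (hp1.le.trans hstrong)
end

section
/- Let $a \ge b > 0$, $t \in (0,1)$, $s = 1 - t$, $\lambda_1 = \frac{s a}{s a + t b}$, $\lambda_2 = \frac{t b}{s a + t b}$, and set $c = \frac{(1 + sa + tb)^{\lambda_1} - 1}{a}$ (the lower endpoint of the feasible NOMA power interval). Then $c \in [0,1]$ and $\min\Big\{ \log_2(1 + c\, a),\ \log_2\big(1 + \tfrac{(1-c) b}{1 + c b}\big) \Big\} \ \ge\ \min\Big\{ \lambda_1 \log_2(1 + sa + tb),\ \lambda_2 \log_2(1 + sa + tb) \Big\}$; i.e., NOMA with this power allocation achieves at least as good worst-user (min-rate) fairness as OMA. -/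
open Real

/-- Fairness: with the lower-endpoint NOMA power allocation
`c = ((1 + s*a + t*b)^λ₁ - 1)/a`, `c ∈ [0,1]` and the worst-user (min) rate
of NOMA is at least the worst-user (min) rate of OMA. -/
theorem noma_min_rate_fairness (a b t s lam1 lam2 c : ℝ) (hb : 0 < b) (hab : b ≤ a)
    (ht0 : 0 < t) (ht1 : t < 1) (hs : s = 1 - t)
    (hl1 : lam1 = s * a / (s * a + t * b)) (hl2 : lam2 = t * b / (s * a + t * b))
    (hc : c = ((1 + s * a + t * b) ^ lam1 - 1) / a) :
    c ∈ Set.Icc (0 : ℝ) 1 ∧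
    min (lam1 * logb 2 (1 + s * a + t * b)) (lam2 * logb 2 (1 + s * a + t * b)) ≤
      min (logb 2 (1 + c * a)) (logb 2 (1 + (1 - c) * b / (1 + c * b))) := by
  have ha : 0 < a := hb.trans_le hab
  have hs0 : 0 < s := by linarith
  have hsa : 0 < s * a := mul_pos hs0 ha
  have htb : 0 < t * b := mul_pos ht0 hb
  have hd : 0 < s * a + t * b := add_pos hsa htb
  have h1 : 0 ≤ lam1 := hl1 ▸ by positivity
  have h2 : 0 ≤ lam2 := hl2 ▸ by positivity
  have hsum : lam1 + lam2 = 1 := by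
    rw [hl1, hl2, ← add_div, div_self hd.ne']
  have hm1 : lam1 * (s * a + t * b) = s * a := by rw [hl1, div_mul_cancel₀ _ hd.ne']
  have hm2 : lam2 * (s * a + t * b) = t * b := by rw [hl2, div_mul_cancel₀ _ hd.ne']
  have hassoc : 1 + s * a + t * b = 1 + (s * a + t * b) := by ring
  have hP1 : 1 ≤ 1 + s * a + t * b := by linarith
  have hP0 : 0 < 1 + s * a + t * b := by linarith
  have hx : (1 + s * a + t * b) ^ lam1 ≤ 1 + s * a := by
    rw [hassoc, ← hm1]
    simpa only [hm1] using
      rpow_one_add_le_one_add_mul_self (by linarith : -1 ≤ s * a + t * b) h1 (by linarith)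
  have hy : (1 + s * a + t * b) ^ lam2 ≤ 1 + t * b := by
    rw [hassoc]
    simpa only [hm2] using
      rpow_one_add_le_one_add_mul_self (by linarith : -1 ≤ s * a + t * b) h2 (by linarith)
  have hxy : (1 + s * a + t * b) ^ lam1 * (1 + s * a + t * b) ^ lam2 = 1 + s * a + t * b := by
    rw [← rpow_add hP0, hsum, rpow_one]
  have hx1 : 1 ≤ (1 + s * a + t * b) ^ lam1 := one_le_rpow hP1 h1
  have hca : 1 + c * a = (1 + s * a + t * b) ^ lam1 := by
    rw [hc, div_mul_cancel₀ _ ha.ne']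
    ring
  have hc0 : 0 ≤ c := hc ▸ div_nonneg (by linarith) ha.le
  have hc1 : c ≤ 1 := by
    rw [hc, div_le_one ha]
    nlinarith
  refine ⟨⟨hc0, hc1⟩, min_le_min ?_ ?_⟩
  · rw [hca, logb_rpow_eq_mul_logb_of_pos hP0]
  · have hcb : 0 < 1 + c * b := by positivity
    have hrate : 1 + (1 - c) * b / (1 + c * b) = (1 + b) / (1 + c * b) := by
      field_simp
      ring
    rw [← logb_rpow_eq_mul_logb_of_pos hP0, hrate]
    refine logb_le_logb_of_le one_lt_two (rpow_pos_of_pos hP0 _) ?_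
    rw [le_div_iff₀ hcb]
    rw [← hca] at hxy
    generalize (1 + s * a + t * b) ^ lam2 = y at hxy hy
    refine le_of_mul_le_mul_left ?_ ha
    calc a * (y * (1 + c * b)) = y * (a - b) + b * ((1 + c * a) * y) := by ring
      _ ≤ (1 + t * b) * (a - b) + b * (1 + s * a + t * b) := by
        rw [hxy]
        gcongr
      _ = a * (1 + b) := by
        rw [hs]
        ring
end

section
/- Let $b > 0$, $t \in [0,1]$, $s = 1 - t$, and define $c = \frac{1 + b - \sqrt{1 + 2 t b}}{b\,\sqrt{1 + 2 t b}}$. Then $c \in [0,1]$, $\frac{(1+b)^2}{(1 + c b)^2} = 1 + 2 t b$ (equivalently, the weak user's NOMA rate equals its equal-DoF OMA rate), and $1 + 2 s b \le (1 + c b)^2$. -/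
open Real

/-- Equal-DoF case, weak-user-tight power allocation: with
`c = (1 + b - √(1 + 2tb)) / (b √(1 + 2tb))`, we have `c ∈ [0,1]`, the weak user's
NOMA rate matches its equal-DoF OMA rate, i.e. `(1+b)²/(1+cb)² = 1 + 2tb`, and
inequality (19): `1 + 2sb ≤ (1 + cb)²`. -/
theorem equal_dof_weak_tight_coeff (b t s c : ℝ) (hb : 0 < b)
    (ht0 : 0 ≤ t) (ht1 : t ≤ 1) (hs : s = 1 - t)
    (hc : c = (1 + b - Real.sqrt (1 + 2 * t * b)) / (b * Real.sqrt (1 + 2 * t * b))) :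
    c ∈ Set.Icc (0 : ℝ) 1 ∧
    (1 + b) ^ 2 / (1 + c * b) ^ 2 = 1 + 2 * t * b ∧
    1 + 2 * s * b ≤ (1 + c * b) ^ 2 := by
  have hpos : 0 < 1 + 2 * t * b := by positivity
  have hsq : √(1 + 2 * t * b) ^ 2 = 1 + 2 * t * b := Real.sq_sqrt hpos.le
  have hr1 : 1 ≤ √(1 + 2 * t * b) := by
    rw [Real.one_le_sqrt]
    nlinarith [mul_nonneg ht0 hb.le]
  have hrb : √(1 + 2 * t * b) ≤ 1 + b := by
    rw [Real.sqrt_le_left (by positivity)]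
    nlinarith [mul_le_mul_of_nonneg_right ht1 hb.le, sq_nonneg b]
  set r := √(1 + 2 * t * b)
  have hr0 : 0 < r := by linarith
  have hcb : 1 + c * b = (1 + b) / r := by
    rw [hc]
    field_simp
    ring
  refine ⟨⟨?_, ?_⟩, ?_, ?_⟩
  · rw [hc]
    exact div_nonneg (by linarith) (by positivity)
  · rw [hc, div_le_one (by positivity)]
    nlinarith
  · rw [hcb, ← hsq]
    field_simp
  · rw [hcb, div_pow, hsq, le_div_iff₀ hpos, hs]
    nlinarith [sq_nonneg ((1 - 2 * t) * b)]
end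

section
/- (Equal DoF, weak-user-tight allocation) Let $a \ge b > 0$, $t \in [0,1]$, $s = 1 - t$, and define $c = \frac{1 + b - \sqrt{1 + 2 t b}}{b\,\sqrt{1 + 2 t b}}$. Then $c \in [0,1]$, $\log_2\Big(1 + \frac{(1-c)\, b}{1 + c\, b}\Big) = \frac{1}{2}\log_2(1 + 2 t b)$, and $\log_2(1 + c\, a) \ge \frac{1}{2}\log_2(1 + 2 s a)$; i.e., with this NOMA power split the weak user's rate equals its equal-DoF OMA rate while the strong user's rate is at least its equal-DoF OMA rate. -/
open Real

/-- Equal DoF, weak-user-tight allocation: with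
`c = (1 + b - √(1 + 2tb)) / (b √(1 + 2tb))`, we have `c ∈ [0,1]`, the weak user's
NOMA rate equals its equal-DoF OMA rate, and the strong user's NOMA rate is at
least its equal-DoF OMA rate. -/
theorem equal_dof_weak_tight (a b t s c : ℝ) (hb : 0 < b) (hab : b ≤ a)
    (ht0 : 0 ≤ t) (ht1 : t ≤ 1) (hs : s = 1 - t)
    (hc : c = (1 + b - Real.sqrt (1 + 2 * t * b)) / (b * Real.sqrt (1 + 2 * t * b))) :
    c ∈ Set.Icc (0 : ℝ) 1 ∧
    logb 2 (1 + (1 - c) * b / (1 + c * b)) = (1 / 2) * logb 2 (1 + 2 * t * b) ∧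
    (1 / 2) * logb 2 (1 + 2 * s * a) ≤ logb 2 (1 + c * a) := by
  have hrad : 1 ≤ 1 + 2 * t * b := by nlinarith [mul_nonneg ht0 hb.le]
  set R := Real.sqrt (1 + 2 * t * b) with hR
  have hRsq : R ^ 2 = 1 + 2 * t * b := Real.sq_sqrt (by linarith)
  have hR1 : 1 ≤ R := Real.one_le_sqrt.mpr hrad
  have hR0 : 0 < R := by linarith
  have hRb : R ≤ 1 + b :=
    Real.sqrt_le_iff.mpr ⟨by linarith, by nlinarith [mul_le_mul_of_nonneg_right ht1 hb.le]⟩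
  have hcR : (1 + c * b) * R = 1 + b := by
    rw [hc]
    field_simp
    ring
  have hc0 : 0 ≤ c := hc ▸ div_nonneg (by linarith) (by positivity)
  have hc1 : c ≤ 1 := by
    rw [hc, div_le_one (by positivity)]
    nlinarith
  have hcb : 0 < 1 + c * b := by positivity
  refine ⟨⟨hc0, hc1⟩, ?_, ?_⟩
  · have hweak : 1 + (1 - c) * b / (1 + c * b) = R := by
      field_simp
      linarith
    rw [hweak, ← hRsq, Real.logb_pow]
    push_cast
    ring
  · have ha : 0 < a := hb.trans_le hab
    have hslack : 2 * s ≤ 2 * c + c ^ 2 * b := by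
      refine le_of_mul_le_mul_right ?_ hb
      rw [hs]
      nlinarith [sq_nonneg (1 + c * b - R)]
    have hsq : 1 + 2 * s * a ≤ (1 + c * a) ^ 2 := by
      have hmono : c ^ 2 * b ≤ c ^ 2 * a := mul_le_mul_of_nonneg_left hab (sq_nonneg c)
      nlinarith [mul_le_mul_of_nonneg_right (hslack.trans (add_le_add_right hmono _)) ha.le]
    have hs0 : 0 ≤ s := by linarith
    have hlog := Real.logb_le_logb_of_le (b := 2) one_lt_two (by positivity) hsq
    rw [Real.logb_pow] at hlog
    push_cast at hlog
    linarith
end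

section
/- (Equal DoF, strong-user-tight allocation) Let $a \ge b > 0$, $s \in [0,1]$, $t = 1 - s$, and define $c = \frac{\sqrt{1 + 2 s a} - 1}{a}$. Then $c \in [0,1]$, $\log_2(1 + c\, a) = \frac{1}{2}\log_2(1 + 2 s a)$, and $\log_2\Big(1 + \frac{(1-c)\, b}{1 + c\, b}\Big) \ge \frac{1}{2}\log_2(1 + 2 t b)$; i.e., with this NOMA power split the strong user's rate equals its equal-DoF OMA rate while the weak user's rate is at least its equal-DoF OMA rate. -/
open Real

/-- Equal DoF, strong-user-tight allocation: with `c = (√(1 + 2sa) - 1)/a`, we have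
`c ∈ [0,1]`, the strong user's NOMA rate equals its equal-DoF OMA rate, and the
weak user's NOMA rate is at least its equal-DoF OMA rate. -/
theorem equal_dof_strong_tight (a b s t c : ℝ) (hb : 0 < b) (hab : b ≤ a)
    (hs0 : 0 ≤ s) (hs1 : s ≤ 1) (ht : t = 1 - s)
    (hc : c = (Real.sqrt (1 + 2 * s * a) - 1) / a) :
    c ∈ Set.Icc (0 : ℝ) 1 ∧
    logb 2 (1 + c * a) = (1 / 2) * logb 2 (1 + 2 * s * a) ∧
    (1 / 2) * logb 2 (1 + 2 * t * b) ≤ logb 2 (1 + (1 - c) * b / (1 + c * b)) := by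
  have ha : 0 < a := hb.trans_le hab
  have hsa : 0 ≤ s * a := mul_nonneg hs0 ha.le
  have ht0 : 0 ≤ t := by linarith
  have hsqrt : 1 + c * a = √(1 + 2 * s * a) := by
    rw [hc]
    field_simp
    ring
  have hc0 : 0 ≤ c := by
    rw [hc]
    exact div_nonneg (sub_nonneg.2 (Real.one_le_sqrt.2 (by linarith))) ha.le
  have hsq : (1 + c * a) ^ 2 = 1 + 2 * s * a := by
    rw [hsqrt, Real.sq_sqrt (by linarith)]
  have hcs : 2 * s = 2 * c + c ^ 2 * a := by
    apply mul_right_cancel₀ ha.ne'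
    linear_combination -hsq
  have hc1 : c ≤ 1 := by
    have := mul_nonneg (sq_nonneg c) ha.le
    linarith
  have hcb : 0 < 1 + c * b := by positivity
  have htb : 0 < 1 + 2 * t * b := by positivity
  refine ⟨⟨hc0, hc1⟩, ?_, ?_⟩
  · rw [← hsq, logb_pow]
    push_cast
    ring
  · have hweak : 1 + (1 - c) * b / (1 + c * b) = (1 + b) / (1 + c * b) := by
      field_simp
      ring
    have hinterf : (1 + c * b) ^ 2 ≤ 1 + 2 * s * b := by
      have := mul_le_mul_of_nonneg_left hab (mul_nonneg (sq_nonneg c) hb.le)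
      linear_combination this - b * hcs
    have hprod : (1 + 2 * s * b) * (1 + 2 * t * b) ≤ (1 + b) ^ 2 := by
      rw [ht]
      linear_combination sq_nonneg (b * (2 * s - 1))
    have hrate : 1 + 2 * t * b ≤ ((1 + b) / (1 + c * b)) ^ 2 := by
      rw [div_pow, le_div_iff₀ (pow_pos hcb 2), mul_comm]
      exact (mul_le_mul_of_nonneg_right hinterf htb.le).trans hprod
    have hlog := logb_le_logb_of_le one_lt_two htb hrate
    rw [logb_pow] at hlog
    push_cast at hlog
    rw [hweak]
    linarith
end

section
/- (Equal DoF, full interval) Let $a \ge b > 0$, $s \in [0,1]$, $t = 1 - s$. Set $c_{\min} = \frac{\sqrt{1 + 2 s a} - 1}{a}$ and $c_{\max} = \frac{1 + b - \sqrt{1 + 2 t b}}{b\,\sqrt{1 + 2 t b}}$. Then $c_{\min} \le c_{\max}$, and for every $c \in [c_{\min}, c_{\max}]$ both $\log_2(1 + c\, a) \ge \frac{1}{2}\log_2(1 + 2 s a)$ and $\log_2\Big(1 + \frac{(1-c)\, b}{1 + c\, b}\Big) \ge \frac{1}{2}\log_2(1 + 2 t b)$ hold; i.e., any NOMA power split in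 this interval gives both users individual rates at least as large as their equal-DoF OMA rates. -/
open Real

/-- Taking a square root halves the logarithm in any base. -/
theorem half_mul_logb_le_logb {B x y : ℝ} (hB : 1 < B) (hx : 0 < x) (h : √x ≤ y) :
    (1 / 2) * logb B x ≤ logb B y := by
  have hsqrt : (1 / 2) * logb B x = logb B √x := by
    rw [logb, logb, log_sqrt hx.le]
    ring
  rw [hsqrt]
  exact logb_le_logb_of_le hB (sqrt_pos.2 hx) h

/-- The difference quotient at `0` of `x ↦ √(1 + 2 * s * x)` is antitone. -/
theorem sqrt_sub_one_div_anti {a b s : ℝ} (hb : 0 < b) (hab : b ≤ a) (hs : 0 ≤ s) :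
    (√(1 + 2 * s * a) - 1) / a ≤ (√(1 + 2 * s * b) - 1) / b := by
  have key : ∀ x : ℝ, 0 < x → (√(1 + 2 * s * x) - 1) / x = 2 * s / (√(1 + 2 * s * x) + 1) := by
    intro x hx
    have hsq : √(1 + 2 * s * x) ^ 2 = 1 + 2 * s * x := sq_sqrt (by positivity)
    rw [div_eq_div_iff hx.ne' (by positivity)]
    linear_combination hsq
  rw [key a (hb.trans_le hab), key b hb]
  gcongr

/-- Equal DoF, full feasible interval: with `c_min = (√(1 + 2sa) - 1)/a` and
`c_max = (1 + b - √(1 + 2tb)) / (b √(1 + 2tb))`, we have `c_min ≤ c_max`, and any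
NOMA power split `(c, 1-c)` with `c ∈ [c_min, c_max]` gives both users individual
rates at least their equal-DoF OMA rates. -/
theorem equal_dof_full_interval (a b s t cmin cmax : ℝ) (hb : 0 < b) (hab : b ≤ a)
    (hs0 : 0 ≤ s) (hs1 : s ≤ 1) (ht : t = 1 - s)
    (hcmin : cmin = (Real.sqrt (1 + 2 * s * a) - 1) / a)
    (hcmax : cmax = (1 + b - Real.sqrt (1 + 2 * t * b)) / (b * Real.sqrt (1 + 2 * t * b))) :
    cmin ≤ cmax ∧
    ∀ c : ℝ, c ∈ Set.Icc cmin cmax →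
      (1 / 2) * logb 2 (1 + 2 * s * a) ≤ logb 2 (1 + c * a) ∧
      (1 / 2) * logb 2 (1 + 2 * t * b) ≤ logb 2 (1 + (1 - c) * b / (1 + c * b)) := by
  have ha : 0 < a := hb.trans_le hab
  have ht0 : 0 ≤ t := by linarith
  have hP : 0 < 1 + 2 * s * a := by positivity
  have hQ : 0 < 1 + 2 * t * b := by positivity
  have hQ0 : 0 < √(1 + 2 * t * b) := sqrt_pos.2 hQ
  refine ⟨?_, fun c ⟨hc₁, hc₂⟩ => ⟨?_, ?_⟩⟩
  · rw [hcmin, hcmax]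
    refine (sqrt_sub_one_div_anti hb hab hs0).trans ?_
    rw [div_le_div_iff₀ hb (by positivity)]
    have hP2 : √(1 + 2 * s * b) ^ 2 = 1 + 2 * s * b := sq_sqrt (by positivity)
    have hQ2 : √(1 + 2 * t * b) ^ 2 = 1 + 2 * t * b := sq_sqrt hQ.le
    have hPQ : √(1 + 2 * s * b) * √(1 + 2 * t * b) ≤ 1 + b := by
      subst ht
      linarith [two_mul_le_add_sq √(1 + 2 * s * b) √(1 + 2 * (1 - s) * b)]
    linarith [mul_le_mul_of_nonneg_left hPQ hb.le]
  · refine half_mul_logb_le_logb one_lt_two hP ?_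
    rw [hcmin, div_le_iff₀ ha] at hc₁
    linarith
  · refine half_mul_logb_le_logb one_lt_two hQ ?_
    have hc0 : 0 ≤ c := by
      refine le_trans ?_ hc₁
      rw [hcmin]
      have h1 : 1 ≤ √(1 + 2 * s * a) := one_le_sqrt.2 (by linarith [mul_nonneg hs0 ha.le])
      exact div_nonneg (by linarith) ha.le
    have hd : 0 < 1 + c * b := by positivity
    have hrate : 1 + (1 - c) * b / (1 + c * b) = (1 + b) / (1 + c * b) := by
      field_simp
      ring
    rw [hcmax, le_div_iff₀ (by positivity)] at hc₂
    rw [hrate, le_div_iff₀ hd]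
    linarith
end
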